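/- Assume P is irreducible; μ(k) ≥ α/n for every k ∈ D, where α > 0; R(i) = 0 for every i ∈ D; and there are constants C > 0 and β > 0 such that S^t(i,j) ≤ C·e^{−β·d(i,j)²} for every i ∈ D, every j ∈ [n] with j ≠ i, and every 1 ≤ t ≤ τ. Then for every i ∈ D, σ_i² ≤ (C/α)·e^{(log c)²/β}·n³·u(i)². -/

import Mathlib

open MeasureTheory Finset Filter
open scoped ENNReal NNReal ENat

noncomputable section

namespace RareTD

variable {n : ℕ}

/-- `P` is a row-stochastic matrix. -/
def IsStochastic (P : Matrix (Fin n) (Fin n) ℝ) : Prop :=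
  (∀ i j, 0 ≤ P i j) ∧ ∀ i, ∑ j, P i j = 1

/-- Irreducibility of a nonnegative matrix. -/
def IsIrreducible (P : Matrix (Fin n) (Fin n) ℝ) : Prop :=
  ∀ i j, ∃ m : ℕ, 0 < m ∧ 0 < (P ^ m) i j

/-- `Pr i` is the law of the Markov chain with transition matrix `P` started at `i`,
characterized by its finite-dimensional distributions. -/
def IsMarkovFamily (P : Matrix (Fin n) (Fin n) ℝ)
    (Pr : Fin n → Measure (ℕ → Fin n)) : Prop :=
  (∀ i, IsProbabilityMeasure (Pr i)) ∧
    ∀ (i : Fin n) (m : ℕ) (x : ℕ → Fin n),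
      (Pr i {ω | ∀ t ≤ m, ω t = x t}).toReal =
        (if x 0 = i then 1 else 0) * ∏ t ∈ Finset.range m, P (x t) (x (t + 1))

/-- The matrix `S` of the chain stopped on exiting `D`. -/
def stopMat (P : Matrix (Fin n) (Fin n) ℝ) (D : Finset (Fin n)) :
    Matrix (Fin n) (Fin n) ℝ :=
  fun i j => if i ∈ D then P i j else if i = j then 1 else 0

/-- Exit time `T = min {t ≥ 0 : ω t ∉ D}`, with value `⊤` if the path never leaves `D`. -/
def exitT (D : Finset (Fin n)) (ω : ℕ → Fin n) : ℕ∞ :=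
  ⨅ (t : ℕ) (_ : ω t ∉ D), (t : ℕ∞)

/-- Hitting time of a set at positive times, `min {t > 0 : ω t ∈ A}`. -/
def hitT (A : Set (Fin n)) (ω : ℕ → Fin n) : ℕ∞ :=
  ⨅ (t : ℕ) (_ : 0 < t ∧ ω t ∈ A), (t : ℕ∞)

/-- The stopped path `t ↦ X_{t ∧ T}`. -/
def stopped (D : Finset (Fin n)) (ω : ℕ → Fin n) : ℕ → Fin n
  | 0 => ω 0
  | t + 1 => if stopped D ω t ∈ D then ω (t + 1) else stopped D ω t

/-- `R_D`, the reward restricted to `D`. -/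
def RD (D : Finset (Fin n)) (R : Fin n → ℝ) : Fin n → ℝ := fun i => if i ∈ D then R i else 0

/-- The value function `u(i) = E_i[∑_{t=0}^{T} R(X_t)]`, in `[0,∞]`. -/
def valueE (Pr : Fin n → Measure (ℕ → Fin n)) (D : Finset (Fin n)) (R : Fin n → ℝ)
    (i : Fin n) : ℝ≥0∞ :=
  ∑' t : ℕ, ∫⁻ ω, Set.indicator {ω' : ℕ → Fin n | (t : ℕ∞) ≤ exitT D ω'}
      (fun ω' => ENNReal.ofReal (R (ω' t))) ω ∂(Pr i)

/-- The real-valued value function. -/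
def valueR (Pr : Fin n → Measure (ℕ → Fin n)) (D : Finset (Fin n)) (R : Fin n → ℝ)
    (i : Fin n) : ℝ := (valueE Pr D R i).toReal

/-- Replace by `0` every row and column with index outside `D`. -/
def zeroD (D : Finset (Fin n)) (M : Matrix (Fin n) (Fin n) ℝ) : Matrix (Fin n) (Fin n) ℝ :=
  fun i j => if i ∈ D ∧ j ∈ D then M i j else 0

/-- The asymptotic variance `σ_i²` of the LSTD estimator. -/
def avar (P : Matrix (Fin n) (Fin n) ℝ) (Pr : Fin n → Measure (ℕ → Fin n))
    (D : Finset (Fin n)) (R : Fin n → ℝ) (μ : Fin n → ℝ) (τ : ℕ) (i : Fin n) : ℝ :=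
  ∑ k ∈ D, (μ k)⁻¹ * ((((1 : Matrix (Fin n) (Fin n) ℝ) - zeroD D (stopMat P D ^ τ))⁻¹) i k) ^ 2 *
    ∫ ω, (∑ t ∈ Finset.range τ, RD D R (stopped D ω t)
        + valueR Pr D R (stopped D ω τ) - valueR Pr D R k) ^ 2 ∂(Pr k)

/-- Mean exit time `E_i[T] = ∑_{t≥0} P_i[T > t]`, in `[0,∞]`. -/
def meanExit (Pr : Fin n → Measure (ℕ → Fin n)) (D : Finset (Fin n)) (i : Fin n) : ℝ≥0∞ :=
  ∑' t : ℕ, Pr i {ω | (t : ℕ∞) < exitT D ω}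

/-- The event `T_ℓ^τ < min (T_k^τ, T_{Dᶜ∖{ℓ}}^τ)` for the `τ`-step chain. -/
def Qset (D : Finset (Fin n)) (k ℓ : Fin n) : Set (ℕ → Fin n) :=
  {ω | hitT {ℓ} ω < min (hitT {k} ω) (hitT ((D : Set (Fin n))ᶜ \ {ℓ}) ω)}

/-- Green's function of the `τ`-step chain: `E_i[∑_{t=0}^{T^τ-1} 1{Y_t^τ = k}]`. -/
def greenY (PrY : Fin n → Measure (ℕ → Fin n)) (D : Finset (Fin n)) (i k : Fin n) : ℝ≥0∞ :=
  ∑' t : ℕ, PrY i {ω | (t : ℕ∞) < exitT D ω ∧ ω t = k}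

/-- Green's function of the chain: `E_ℓ[∑_{t=0}^{T} 1{X_t = j}]` (the sum includes `t = T`). -/
def greenX (Pr : Fin n → Measure (ℕ → Fin n)) (D : Finset (Fin n)) (ℓ j : Fin n) : ℝ≥0∞ :=
  ∑' t : ℕ, Pr ℓ {ω | (t : ℕ∞) ≤ exitT D ω ∧ ω t = j}


/-- Lengths of paths from `k` to `ℓ` in the minorizing graph (edges `i → j` with `A i j ≥ c`)
whose intermediate vertices lie in `D \ {k}`. -/
def pathLens {n : ℕ} (A : Matrix (Fin n) (Fin n) ℝ) (c : ℝ) (D : Finset (Fin n))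
    (k ℓ : Fin n) : Set ℕ :=
  {d | ∃ v : ℕ → Fin n, v 0 = k ∧ v d = ℓ ∧
    (∀ m, 0 < m → m < d → v m ∈ D ∧ v m ≠ k) ∧
    ∀ m < d, c ≤ A (v m) (v (m + 1))}

/-- The graph distance `d(k,ℓ)`: the minimal length of a path from `k` to `ℓ` in the minorizing
graph whose intermediate vertices lie in `D \ {k}`. -/
noncomputable def gdist {n : ℕ} (A : Matrix (Fin n) (Fin n) ℝ) (c : ℝ) (D : Finset (Fin n))
    (k ℓ : Fin n) : ℕ :=
  sInf (pathLens A c D k ℓ)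

/-! ### A minimum principle and the Green's function bound -/

/-- Minimum principle: a function superharmonic off `B` and nonnegative on `B` is nonnegative,
provided that `B` is reachable from everywhere. -/
theorem nonneg_of_superharmonic {A : Matrix (Fin n) (Fin n) ℝ} (hA : IsStochastic A)
    {c : ℝ} (hc : 0 < c) {B : Set (Fin n)}
    (hreach : ∀ x, ∃ (v : ℕ → Fin n) (d : ℕ), v 0 = x ∧ v d ∈ B ∧
      ∀ m < d, c ≤ A (v m) (v (m + 1)))
    {f : Fin n → ℝ} (hB : ∀ x ∈ B, 0 ≤ f x) (hf : ∀ x ∉ B, ∑ y, A x y * f y ≤ f x)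
    (x : Fin n) : 0 ≤ f x := by
  by_contra! hx
  have : Nonempty (Fin n) := ⟨x⟩
  obtain ⟨a, ha⟩ := Finite.exists_min f
  have hneg : f a < 0 := (ha x).trans_lt hx
  obtain ⟨v, d, hv0, hvd, hv⟩ := hreach a
  have key : ∀ m ≤ d, f (v m) = f a := by
    intro m
    induction m with
    | zero => intro _; rw [hv0]
    | succ m ih =>
      intro hm
      have h1 := ih (by omega)
      have hnB : v m ∉ B := fun h => by linarith [hB _ h]
      have h2 : ∑ y, A (v m) y * (f y - f a) ≤ 0 := by
        simp only [mul_sub, Finset.sum_sub_distrib, ← Finset.sum_mul, hA.2]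
        linarith [hf _ hnB]
      have h3 : A (v m) (v (m + 1)) * (f (v (m + 1)) - f a) ≤ 0 :=
        (Finset.single_le_sum
          (f := fun y => A (v m) y * (f y - f a))
          (fun y _ => mul_nonneg (hA.1 _ _) (sub_nonneg.2 (ha y))) (Finset.mem_univ _)).trans h2
      have h4 : 0 < A (v m) (v (m + 1)) := hc.trans_le (hv m (by omega))
      have h5 := nonpos_of_mul_nonpos_right h3 h4
      linarith [ha (v (m + 1))]
  linarith [key d le_rfl, hB _ hvd]

/-- Following a path of edges of weight at least `c` costs a factor `c` per step. -/
theorem pow_mul_le_of_mem_pathLens {A : Matrix (Fin n) (Fin n) ℝ} (hA : ∀ i j, 0 ≤ A i j)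
    {c : ℝ} (hc : 0 < c) {D : Finset (Fin n)} {k ℓ : Fin n} (hkℓ : ℓ ≠ k) {d : ℕ}
    (hd : d ∈ pathLens A c D k ℓ) {w : Fin n → ℝ} (hw : ∀ x, 0 ≤ w x)
    (hharm : ∀ x ∈ D, x ≠ k → ∑ y, A x y * w y = w x) :
    c ^ d * w ℓ ≤ ∑ y, A k y * w y := by
  obtain ⟨v, hv0, hvd, hmid, hedge⟩ := hd
  have hstep : ∀ m < d, c * w (v (m + 1)) ≤ ∑ y, A (v m) y * w y := fun m hm =>
    (mul_le_mul_of_nonneg_right (hedge m hm) (hw _)).trans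
      (Finset.single_le_sum (f := fun y => A (v m) y * w y)
        (fun y _ => mul_nonneg (hA _ _) (hw y)) (Finset.mem_univ _))
  have key : ∀ m, m < d → c ^ (m + 1) * w (v (m + 1)) ≤ ∑ y, A k y * w y := by
    intro m
    induction m with
    | zero => intro hm; simpa [hv0] using hstep 0 hm
    | succ m ih =>
      intro hm
      refine le_trans ?_ (ih (by omega))
      have h := hmid (m + 1) (by omega) hm
      have h1 := hstep (m + 1) hm
      rw [hharm _ h.1 h.2] at h1
      rw [pow_succ, mul_assoc]
      exact mul_le_mul_of_nonneg_left h1 (by positivity)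
  rcases d with _ | d
  · exact absurd (hvd.symm.trans hv0) hkℓ
  · simpa [hvd] using key d (Nat.lt_succ_self d)

/-- The Green's function of a killed chain controls the increments of a nonnegative harmonic
function. -/
theorem green_mul_abs_sub_le {A : Matrix (Fin n) (Fin n) ℝ} (hA : IsStochastic A)
    {c : ℝ} (hc : 0 < c) {D : Finset (Fin n)} (hDne : D ≠ Finset.univ)
    (hconn : ∀ k ∈ D, ∀ ℓ, ℓ ≠ k → (pathLens A c D k ℓ).Nonempty)
    {u : Fin n → ℝ} (hu0 : ∀ x, 0 ≤ u x) (hu : ∀ x ∈ D, ∑ y, A x y * u y = u x)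
    {k : Fin n} (hk : k ∈ D) {g : Fin n → ℝ} (hg0 : ∀ x ∉ D, g x = 0)
    (hg : ∀ x ∈ D, g x - ∑ y, A x y * g y = if x = k then 1 else 0)
    {ℓ : Fin n} (hℓ : ℓ ≠ k) {d : ℕ} (hd : d ∈ pathLens A c D k ℓ) (i : Fin n) :
    0 ≤ g i ∧ c ^ d * (g i * |u ℓ - u k|) ≤ u i := by
  obtain ⟨o, ho⟩ : ∃ o, o ∉ D := by
    by_contra! h
    exact hDne (Finset.eq_univ_iff_forall.2 h)
  have hreach : ∀ B : Set (Fin n), (∀ x ∉ D, x ∈ B) →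
      ∀ x, ∃ (v : ℕ → Fin n) (d : ℕ), v 0 = x ∧ v d ∈ B ∧ ∀ m < d, c ≤ A (v m) (v (m + 1)) := by
    intro B hB x
    by_cases hx : x ∈ D
    · obtain ⟨d, v, h0, h1, -, h2⟩ := hconn x hx o (fun h => ho (h ▸ hx))
      exact ⟨v, d, h0, h1 ▸ hB o ho, h2⟩
    · exact ⟨fun _ => x, 0, rfl, hB x hx, by simp⟩
  have hg_nonneg : ∀ x, 0 ≤ g x :=
    nonneg_of_superharmonic hA hc (B := {x | x ∉ D}) (hreach _ fun _ h => h)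
      (fun x hx => (hg0 x hx).ge) (fun x hx => by
        have := hg x (not_not.1 hx)
        split_ifs at this <;> linarith)
  have hreach' := hreach {x | x ∉ D ∨ x = k} (fun _ h => Or.inl h)
  have hgz : ∀ x, ∑ y, A x y * (g k - g y) = g k - ∑ y, A x y * g y := fun x => by
    simp only [mul_sub, Finset.sum_sub_distrib, ← Finset.sum_mul, hA.2, one_mul]
  have hgw : ∀ x, ∑ y, A x y * (g k * u y - u k * g y)
      = g k * ∑ y, A x y * u y - u k * ∑ y, A x y * g y := fun x => by
    simp only [mul_sub, Finset.sum_sub_distrib, Finset.mul_sum, mul_left_comm]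
  have hzh : ∀ x ∈ D, x ≠ k → ∑ y, A x y * (g k - g y) = g k - g x := fun x hx hxk => by
    have := hg x hx
    rw [if_neg hxk] at this
    rw [hgz]; linarith
  have hwh : ∀ x ∈ D, x ≠ k →
      ∑ y, A x y * (g k * u y - u k * g y) = g k * u x - u k * g x := fun x hx hxk => by
    have := hg x hx
    rw [if_neg hxk, sub_eq_zero] at this
    rw [hgw, hu x hx, ← this]
  have hz : ∀ x, 0 ≤ g k - g x :=
    nonneg_of_superharmonic hA hc hreach'
      (by
        rintro x (hx | rfl)
        · simpa [hg0 x hx] using hg_nonneg k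
        · simp)
      (fun x hx => by
        simp only [Set.mem_ofPred_eq, not_or, not_not] at hx
        exact (hzh x hx.1 hx.2).le)
  have hw : ∀ x, 0 ≤ g k * u x - u k * g x :=
    nonneg_of_superharmonic hA hc hreach'
      (by
        rintro x (hx | rfl)
        · simpa [hg0 x hx] using mul_nonneg (hg_nonneg k) (hu0 x)
        · simp [mul_comm])
      (fun x hx => by
        simp only [Set.mem_ofPred_eq, not_or, not_not] at hx
        exact (hwh x hx.1 hx.2).le)
  have hgk := hg k hk
  rw [if_pos rfl] at hgk
  have hgk1 : 1 ≤ g k := by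
    have : 0 ≤ ∑ y, A k y * g y :=
      Finset.sum_nonneg fun y _ => mul_nonneg (hA.1 _ _) (hg_nonneg y)
    linarith
  have hz_le : c ^ d * (g k - g ℓ) ≤ 1 := by
    have := pow_mul_le_of_mem_pathLens hA.1 hc hℓ hd hz hzh
    rw [hgz] at this
    linarith
  have hw_le : c ^ d * (g k * u ℓ - u k * g ℓ) ≤ u k := by
    have := pow_mul_le_of_mem_pathLens hA.1 hc hℓ hd hw hwh
    rw [hgw, hu k hk, show ∑ y, A k y * g y = g k - 1 by linarith] at this
    linarith
  have hcd : 0 < c ^ d := by positivity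
  have hdiag : c ^ d * (g k * |u ℓ - u k|) ≤ u k := by
    rcases abs_cases (u ℓ - u k) with ⟨h, -⟩ | ⟨h, -⟩ <;> rw [h]
    · refine le_trans (mul_le_mul_of_nonneg_left ?_ hcd.le) hw_le
      nlinarith [mul_nonneg (hu0 k) (hz ℓ)]
    · calc c ^ d * (g k * -(u ℓ - u k)) ≤ c ^ d * (u k * (g k - g ℓ)) :=
            mul_le_mul_of_nonneg_left (by linarith [hw ℓ]) hcd.le
        _ = u k * (c ^ d * (g k - g ℓ)) := by ring
        _ ≤ u k := mul_le_of_le_one_right (hu0 k) hz_le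
  refine ⟨hg_nonneg i, le_of_mul_le_mul_left ?_ (zero_lt_one.trans_le hgk1)⟩
  calc g k * (c ^ d * (g i * |u ℓ - u k|)) = g i * (c ^ d * (g k * |u ℓ - u k|)) := by ring
    _ ≤ g i * u k := mul_le_mul_of_nonneg_left hdiag (hg_nonneg i)
    _ ≤ g k * u i := by linarith [hw i]

/-! ### The stopped chain -/

theorem stopMat_isStochastic {P : Matrix (Fin n) (Fin n) ℝ} (hP : IsStochastic P)
    (D : Finset (Fin n)) : IsStochastic (stopMat P D) := by
  refine ⟨fun i j => ?_, fun i => ?_⟩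
  · unfold stopMat
    split_ifs
    exacts [hP.1 i j, zero_le_one, le_rfl]
  · by_cases h : i ∈ D <;> simp [stopMat, h, hP.2]

theorem IsStochastic.pow {P : Matrix (Fin n) (Fin n) ℝ} (hP : IsStochastic P) (t : ℕ) :
    IsStochastic (P ^ t) := by
  induction t with
  | zero =>
    refine ⟨fun i j => ?_, fun i => by simp [Matrix.one_apply]⟩
    rw [pow_zero, Matrix.one_apply]
    split_ifs <;> norm_num
  | succ t ih =>
    refine ⟨fun i j => ?_, fun i => ?_⟩
    · rw [pow_succ, Matrix.mul_apply]
      exact Finset.sum_nonneg fun k _ => mul_nonneg (ih.1 _ _) (hP.1 _ _)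
    · simp only [pow_succ, Matrix.mul_apply]
      rw [Finset.sum_comm]
      simp only [← Finset.mul_sum, hP.2, mul_one, ih.2]

theorem le_exitT_iff {D : Finset (Fin n)} {ω : ℕ → Fin n} {t : ℕ} :
    (t : ℕ∞) ≤ exitT D ω ↔ ∀ s < t, ω s ∈ D := by
  simp only [exitT, le_iInf_iff, Nat.cast_le]
  exact ⟨fun h s hs => by_contra fun hn => absurd (h s hn) (by omega),
    fun h s hs => by_contra fun hn => hs (h s (by omega))⟩

theorem stopped_eq_of_forall_mem {D : Finset (Fin n)} {ω : ℕ → Fin n} {t : ℕ}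
    (h : ∀ s < t, ω s ∈ D) : stopped D ω t = ω t := by
  induction t with
  | zero => rfl
  | succ t ih =>
    rw [stopped, ih fun s hs => h s (by omega), if_pos (h t (by omega))]

theorem stopped_mem_iff {D : Finset (Fin n)} {ω : ℕ → Fin n} {t : ℕ} :
    stopped D ω t ∈ D ↔ ∀ s < t + 1, ω s ∈ D := by
  induction t with
  | zero => simp [stopped]
  | succ t ih =>
    by_cases h : stopped D ω t ∈ D
    · rw [stopped, if_pos h, Nat.forall_lt_succ_right]
      exact ⟨fun h' => ⟨ih.1 h, h'⟩, fun h' => h'.2⟩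
    · rw [stopped, if_neg h]
      exact iff_of_false h fun h' => h (ih.2 fun s hs => h' s (by omega))

theorem stopped_congr {D : Finset (Fin n)} {ω ω' : ℕ → Fin n} {t : ℕ}
    (h : ∀ s ≤ t, ω s = ω' s) : stopped D ω t = stopped D ω' t := by
  induction t with
  | zero => exact h 0 le_rfl
  | succ t ih => rw [stopped, stopped, ih fun s hs => h s (by omega), h (t + 1) le_rfl]

theorem measurable_stopped (D : Finset (Fin n)) (t : ℕ) :
    Measurable fun ω : ℕ → Fin n => stopped D ω t := by
  induction t with
  | zero => exact measurable_pi_apply 0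
  | succ t ih =>
    exact Measurable.ite (ih (MeasurableSet.of_discrete (s := {x | x ∈ D})))
      (measurable_pi_apply (t + 1)) ih

/-- Extension of a finite path to an infinite one, constant after its last vertex. -/
def extendPath {m : ℕ} (x : Fin (m + 1) → Fin n) (t : ℕ) : Fin n :=
  x ⟨min t m, by omega⟩

theorem extendPath_snoc {m : ℕ} (x : Fin (m + 1) → Fin n) (b : Fin n) {t : ℕ} (ht : t ≤ m) :
    extendPath (Fin.snoc (α := fun _ => Fin n) x b) t = extendPath x t := by
  have : (⟨min t (m + 1), by omega⟩ : Fin (m + 1 + 1)) = Fin.castSucc ⟨min t m, by omega⟩ := by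
    ext; simp; omega
  rw [extendPath, this, Fin.snoc_castSucc, extendPath]

theorem extendPath_snoc_last {m : ℕ} (x : Fin (m + 1) → Fin n) (b : Fin n) :
    extendPath (Fin.snoc (α := fun _ => Fin n) x b) (m + 1) = b := by
  have : (⟨min (m + 1) (m + 1), by omega⟩ : Fin (m + 1 + 1)) = Fin.last (m + 1) := by
    ext; simp
  rw [extendPath, this, Fin.snoc_last]

/-- Expectation of a function of the first `m + 1` coordinates of the chain. -/
theorem IsMarkovFamily.integral_eq_sum {P : Matrix (Fin n) (Fin n) ℝ}
    {Pr : Fin n → Measure (ℕ → Fin n)} (hPr : IsMarkovFamily P Pr) (i : Fin n) {m : ℕ}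
    {f : (ℕ → Fin n) → ℝ} (hf : ∀ ω ω', (∀ s ≤ m, ω s = ω' s) → f ω = f ω') :
    ∫ ω, f ω ∂(Pr i) = ∑ x : Fin (m + 1) → Fin n, (if extendPath x 0 = i then 1 else 0) *
      (∏ t ∈ Finset.range m, P (extendPath x t) (extendPath x (t + 1))) * f (extendPath x) := by
  have := hPr.1 i
  have hr : Measurable fun (ω : ℕ → Fin n) (s : Fin (m + 1)) => ω s :=
    measurable_pi_lambda _ fun s => measurable_pi_apply _
  have h1 : ∫ ω, f ω ∂(Pr i) =
      ∫ x, f (extendPath x) ∂((Pr i).map fun (ω : ℕ → Fin n) (s : Fin (m + 1)) => ω s) := by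
    rw [integral_map hr.aemeasurable (measurable_of_finite _).aestronglyMeasurable]
    refine integral_congr_ae (ae_of_all _ fun ω => hf _ _ fun s hs => ?_)
    simp [extendPath, hs]
  have := Measure.isProbabilityMeasure_map (μ := Pr i) hr.aemeasurable
  rw [h1, integral_fintype (Integrable.of_finite)]
  refine Finset.sum_congr rfl fun x _ => ?_
  rw [smul_eq_mul, ← hPr.2 i m (extendPath x), Measure.real,
    Measure.map_apply hr (measurableSet_singleton x)]
  congr 3
  ext ω
  simp only [Set.mem_preimage, Set.mem_singleton_iff, Set.mem_ofPred_eq, funext_iff]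
  refine ⟨fun h t ht => ?_, fun h s => ?_⟩
  · simpa [extendPath, ht] using h ⟨t, by omega⟩
  · have hs : (s : ℕ) ≤ m := by omega
    simpa [extendPath, hs] using h s hs

theorem IsMarkovFamily.integral_stopped_succ {P : Matrix (Fin n) (Fin n) ℝ}
    (hP : IsStochastic P) {Pr : Fin n → Measure (ℕ → Fin n)} (hPr : IsMarkovFamily P Pr)
    (D : Finset (Fin n)) (t : ℕ) (f : Fin n → ℝ) (i : Fin n) :
    ∫ ω, f (stopped D ω (t + 1)) ∂(Pr i)
      = ∫ ω, ∑ j, stopMat P D (stopped D ω t) j * f j ∂(Pr i) := by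
  rw [hPr.integral_eq_sum i (m := t + 1) (fun ω ω' h => by rw [stopped_congr h]),
    hPr.integral_eq_sum i (m := t) (fun ω ω' h => by rw [stopped_congr h]),
    ← (Fin.snocEquiv fun _ : Fin (t + 2) => Fin n).sum_comp, Fintype.sum_prod_type,
    Finset.sum_comm]
  refine Finset.sum_congr rfl fun x _ => ?_
  simp only [Fin.snocEquiv, Equiv.coe_fn_mk]
  have hst : ∀ b, stopped D (extendPath (Fin.snoc (α := fun _ => Fin n) x b)) t
      = stopped D (extendPath x) t :=
    fun b => stopped_congr fun s hs => extendPath_snoc x b hs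
  have hprod : ∀ b, ∏ s ∈ Finset.range t,
      P (extendPath (Fin.snoc (α := fun _ => Fin n) x b) s)
        (extendPath (Fin.snoc (α := fun _ => Fin n) x b) (s + 1))
      = ∏ s ∈ Finset.range t, P (extendPath x s) (extendPath x (s + 1)) := fun b =>
    Finset.prod_congr rfl fun s hs => by
      have := Finset.mem_range.1 hs
      rw [extendPath_snoc x b (by omega), extendPath_snoc x b (by omega)]
  simp only [Finset.prod_range_succ, hprod, extendPath_snoc x _ (Nat.zero_le t),
    extendPath_snoc x _ le_rfl, extendPath_snoc_last, stopped, hst]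
  rw [Finset.mul_sum]
  by_cases h : stopped D (extendPath x) t ∈ D
  · have hx : stopped D (extendPath x) t = extendPath x t :=
      stopped_eq_of_forall_mem fun s hs => stopped_mem_iff.1 h s (by omega)
    simp only [if_pos h, stopMat]
    rw [hx]
    exact Finset.sum_congr rfl fun b _ => by ring
  · simp only [if_neg h, stopMat]
    simp only [ite_mul, one_mul, zero_mul, mul_ite, mul_zero, Finset.sum_ite_eq,
      Finset.mem_univ, if_true]
    split_ifs
    · rw [← Finset.sum_mul, ← Finset.mul_sum, hP.2, mul_one]
    · simp

/-- The stopped chain has transition matrix `stopMat P D`. -/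
theorem IsMarkovFamily.integral_stopped {P : Matrix (Fin n) (Fin n) ℝ}
    (hP : IsStochastic P) {Pr : Fin n → Measure (ℕ → Fin n)} (hPr : IsMarkovFamily P Pr)
    (D : Finset (Fin n)) (t : ℕ) (f : Fin n → ℝ) (i : Fin n) :
    ∫ ω, f (stopped D ω t) ∂(Pr i) = ∑ j, (stopMat P D ^ t) i j * f j := by
  induction t generalizing f with
  | zero =>
    rw [hPr.integral_eq_sum i (m := 0) (fun ω ω' h => by rw [stopped_congr h]),
      ← (Equiv.funUnique (Fin 1) (Fin n)).symm.sum_comp]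
    simp [extendPath, stopped, Matrix.one_apply, eq_comm]
  | succ t ih =>
    rw [hPr.integral_stopped_succ hP, ih fun a => ∑ j, stopMat P D a j * f j]
    simp only [pow_succ, Matrix.mul_apply, Finset.mul_sum, Finset.sum_mul, mul_assoc]
    exact Finset.sum_comm

/-! ### The value function for a reward vanishing on `D` -/

theorem sum_indicator_eq_stopped {D : Finset (Fin n)} {R : Fin n → ℝ} (hRD : ∀ i ∈ D, R i = 0)
    (ω : ℕ → Fin n) (N : ℕ) :
    ∑ t ∈ Finset.range (N + 1), Set.indicator {ω' : ℕ → Fin n | (t : ℕ∞) ≤ exitT D ω'}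
      (fun ω' => ENNReal.ofReal (R (ω' t))) ω = ENNReal.ofReal (R (stopped D ω N)) := by
  induction N with
  | zero => simp [stopped]
  | succ N ih =>
    have hmem : ω ∈ {ω' | ((N + 1 : ℕ) : ℕ∞) ≤ exitT D ω'} ↔ stopped D ω N ∈ D :=
      le_exitT_iff.trans stopped_mem_iff.symm
    rw [Finset.sum_range_succ, ih, stopped]
    by_cases h : stopped D ω N ∈ D
    · rw [if_pos h, Set.indicator_of_mem (hmem.2 h), hRD _ h, ENNReal.ofReal_zero, zero_add]
    · rw [if_neg h, Set.indicator_of_notMem (mt hmem.1 h), add_zero]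

theorem tendsto_stopMat_pow_valueR {P : Matrix (Fin n) (Fin n) ℝ} (hP : IsStochastic P)
    {Pr : Fin n → Measure (ℕ → Fin n)} (hPr : IsMarkovFamily P Pr) {D : Finset (Fin n)}
    {R : Fin n → ℝ} (hR : ∀ i, 0 ≤ R i) (hRD : ∀ i ∈ D, R i = 0) (i : Fin n) :
    Tendsto (fun N => ∑ j, (stopMat P D ^ N) i j * R j) atTop (nhds (valueR Pr D R i)) := by
  have := hPr.1 i
  have hmeas : ∀ t : ℕ, Measurable (Set.indicator {ω' : ℕ → Fin n | (t : ℕ∞) ≤ exitT D ω'}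
      (fun ω' => ENNReal.ofReal (R (ω' t)))) := by
    intro t
    refine Measurable.indicator ((measurable_of_finite fun a => ENNReal.ofReal (R a)).comp
      (measurable_pi_apply t)) ?_
    simp only [le_exitT_iff, Set.ofPred_forall]
    exact MeasurableSet.iInter fun s => MeasurableSet.iInter fun _ =>
      measurable_pi_apply s (MeasurableSet.of_discrete (s := {x | x ∈ D}))
  have hpart : ∀ N : ℕ, ∑ t ∈ Finset.range (N + 1),
      ∫⁻ ω, Set.indicator {ω' : ℕ → Fin n | (t : ℕ∞) ≤ exitT D ω'}
        (fun ω' => ENNReal.ofReal (R (ω' t))) ω ∂(Pr i)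
      = ENNReal.ofReal (∑ j, (stopMat P D ^ N) i j * R j) := by
    intro N
    rw [← lintegral_finsetSum _ fun t _ => hmeas t]
    simp only [sum_indicator_eq_stopped hRD]
    rw [← hPr.integral_stopped hP, ofReal_integral_eq_lintegral_ofReal
      ?_ (ae_of_all _ fun ω => hR _)]
    exact Integrable.comp_measurable (f := fun ω => stopped D ω N) (g := R)
      (Integrable.of_finite (μ := (Pr i).map fun ω => stopped D ω N)) (measurable_stopped D N)
  have hlim : Tendsto (fun N => ENNReal.ofReal (∑ j, (stopMat P D ^ N) i j * R j)) atTop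
      (nhds (valueE Pr D R i)) := by
    simp only [← hpart]
    exact (tendsto_add_atTop_iff_nat 1).2 ENNReal.summable.hasSum.tendsto_sum_nat
  have hstoch := fun N => (stopMat_isStochastic hP D).pow N
  have hfin : valueE Pr D R i ≠ ⊤ := by
    refine ne_top_of_le_ne_top (ENNReal.ofReal_ne_top (r := ∑ j, R j))
      (le_of_tendsto' hlim fun N => ENNReal.ofReal_le_ofReal
        (Finset.sum_le_sum fun j _ => mul_le_of_le_one_left (hR j) ?_))
    rw [← (hstoch N).2 i]
    exact Finset.single_le_sum (f := fun j => (stopMat P D ^ N) i j)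
      (fun j _ => (hstoch N).1 i j) (Finset.mem_univ j)
  refine ((ENNReal.tendsto_toReal hfin).comp hlim).congr fun N => ENNReal.toReal_ofReal ?_
  exact Finset.sum_nonneg fun j _ => mul_nonneg ((hstoch N).1 i j) (hR j)

/-- The value function is harmonic for every power of the stopped transition matrix. -/
theorem sum_stopMat_pow_mul_valueR {P : Matrix (Fin n) (Fin n) ℝ} (hP : IsStochastic P)
    {Pr : Fin n → Measure (ℕ → Fin n)} (hPr : IsMarkovFamily P Pr) {D : Finset (Fin n)}
    {R : Fin n → ℝ} (hR : ∀ i, 0 ≤ R i) (hRD : ∀ i ∈ D, R i = 0) (τ : ℕ) (i : Fin n) :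
    ∑ j, (stopMat P D ^ τ) i j * valueR Pr D R j = valueR Pr D R i := by
  refine tendsto_nhds_unique (tendsto_finsetSum _ fun j _ =>
    (tendsto_stopMat_pow_valueR hP hPr hR hRD j).const_mul ((stopMat P D ^ τ) i j)) ?_
  refine ((tendsto_add_atTop_iff_nat τ).2
    (tendsto_stopMat_pow_valueR hP hPr hR hRD i)).congr fun N => ?_
  simp only [add_comm N, pow_add, Matrix.mul_apply, Finset.mul_sum, Finset.sum_mul, mul_assoc]
  exact Finset.sum_comm

/-! ### The variance bound -/

/-- Completing the square in the exponent. -/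
theorem exp_neg_mul_sq_le {c β : ℝ} (hc : 0 < c) (hβ : 0 < β) (d : ℕ) :
    Real.exp (-β * (d : ℝ) ^ 2) ≤ Real.exp ((Real.log c) ^ 2 / β) * (c ^ d) ^ 2 := by
  have : (c ^ d) ^ 2 = Real.exp (2 * d * Real.log c) := by
    rw [← pow_mul, ← Real.exp_log (pow_pos hc (d * 2)), Real.log_pow]
    push_cast
    ring_nf
  rw [this, ← Real.exp_add, Real.exp_le_exp]
  have h : 0 ≤ (β * d + Real.log c) ^ 2 / β := by positivity
  have h' : (β * d + Real.log c) ^ 2 / β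
      = β * d ^ 2 + 2 * d * Real.log c + Real.log c ^ 2 / β := by
    field_simp
    ring
  linarith

/-- Columns of `(I - A_D)⁻¹` solve the Poisson equation of the killed chain. -/
theorem poisson_of_isUnit_det {A : Matrix (Fin n) (Fin n) ℝ} {D : Finset (Fin n)}
    (h : IsUnit (1 - zeroD D A).det) {k : Fin n} (hk : k ∈ D) :
    (∀ x ∉ D, (1 - zeroD D A)⁻¹ x k = 0) ∧ ∀ x ∈ D,
      (1 - zeroD D A)⁻¹ x k - ∑ y, A x y * (1 - zeroD D A)⁻¹ y k = if x = k then 1 else 0 := by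
  have hmul : ∀ x, (1 - zeroD D A)⁻¹ x k - ∑ y, zeroD D A x y * (1 - zeroD D A)⁻¹ y k
      = if x = k then 1 else 0 := fun x => by
    have := congrFun (congrFun (Matrix.mul_nonsing_inv _ h) x) k
    rwa [sub_mul, one_mul, Matrix.sub_apply, Matrix.mul_apply, Matrix.one_apply] at this
  have h0 : ∀ x ∉ D, (1 - zeroD D A)⁻¹ x k = 0 := fun x hx => by
    have hxk : x ≠ k := fun e => hx (e ▸ hk)
    simpa [zeroD, hx, hxk] using hmul x
  refine ⟨h0, fun x hx => ?_⟩
  rw [← hmul x]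
  congr 1
  refine Finset.sum_congr rfl fun y _ => ?_
  by_cases hy : y ∈ D
  · simp [zeroD, hx, hy]
  · simp [h0 y hy]

/-- Theorem 2 of the paper, bound (12): under the rare-event assumptions and
with reward vanishing on `D`, `σ_i² ≤ (C/α) e^{(log c)²/β} n³ u(i)²`. -/
theorem stmt7 {n : ℕ} (hn : 2 ≤ n) (D : Finset (Fin n)) (hD : D.Nonempty)
    (hDne : D ≠ Finset.univ)
    (P : Matrix (Fin n) (Fin n) ℝ) (hP : IsStochastic P) (hirr : IsIrreducible P)
    (R : Fin n → ℝ) (hR : ∀ i, 0 ≤ R i) (hRD : ∀ i ∈ D, R i = 0)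
    (τ : ℕ) (hτ : 1 ≤ τ)
    (μ : Fin n → ℝ) (hμ0 : ∀ i, 0 ≤ μ i) (hμ1 : ∑ i, μ i = 1)
    (hμsupp : ∀ i ∉ D, μ i = 0)
    (Pr : Fin n → Measure (ℕ → Fin n)) (hPr : IsMarkovFamily P Pr)
    -- the minorizing graph (edges `i → j` with `S^τ(i,j) ≥ c`) is suitably connected
    (c : ℝ) (hc0 : 0 < c) (hc1 : c ≤ 1)
    (hconn : ∀ k ∈ D, ∀ ℓ, ℓ ≠ k → (pathLens (stopMat P D ^ τ) c D k ℓ).Nonempty)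
    -- Assumption 1: `μ(k) ≥ α/n` on `D`
    (α : ℝ) (hα : 0 < α) (hμlb : ∀ k ∈ D, α / n ≤ μ k)
    -- Assumption 3: sub-Gaussian transition probability tails
    (C β : ℝ) (hC : 0 < C) (hβ : 0 < β)
    (hdecay : ∀ i ∈ D, ∀ j, j ≠ i → ∀ t, 1 ≤ t → t ≤ τ →
      (stopMat P D ^ t) i j
        ≤ C * Real.exp (-β * (gdist (stopMat P D ^ τ) c D i j : ℝ) ^ 2))
    (i : Fin n) (hi : i ∈ D) :
    avar P Pr D R μ τ i
      ≤ C / α * Real.exp ((Real.log c) ^ 2 / β) * n ^ 3 * (valueR Pr D R i) ^ 2 := by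
  have hst := (stopMat_isStochastic hP D).pow τ
  have hu0 : ∀ x, 0 ≤ valueR Pr D R x := fun x => ENNReal.toReal_nonneg
  have hn0 : (0 : ℝ) < n := by exact_mod_cast (by omega : 0 < n)
  have hint : ∀ k, ∫ ω, (∑ t ∈ Finset.range τ, RD D R (stopped D ω t)
        + valueR Pr D R (stopped D ω τ) - valueR Pr D R k) ^ 2 ∂(Pr k)
      = ∑ ℓ, (stopMat P D ^ τ) k ℓ * (valueR Pr D R ℓ - valueR Pr D R k) ^ 2 := fun k => by
    rw [← hPr.integral_stopped hP D τ fun ℓ => (valueR Pr D R ℓ - valueR Pr D R k) ^ 2]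
    have : ∀ x, RD D R x = 0 := fun x => by
      unfold RD
      split_ifs with h
      exacts [hRD x h, rfl]
    simp [this]
  unfold avar
  simp only [hint]
  by_cases hdet : IsUnit (1 - zeroD D (stopMat P D ^ τ)).det
  swap
  · rw [Matrix.nonsing_inv_apply_not_isUnit _ hdet]
    simp only [Matrix.zero_apply]
    norm_num
    positivity
  set G := (1 - zeroD D (stopMat P D ^ τ))⁻¹
  set u := valueR Pr D R
  set E := C * Real.exp ((Real.log c) ^ 2 / β) with hE
  have hE0 : 0 < E := by positivity
  have hterm : ∀ k ∈ D, ∀ ℓ,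
      (G i k) ^ 2 * ((stopMat P D ^ τ) k ℓ * (u ℓ - u k) ^ 2) ≤ E * u i ^ 2 := by
    intro k hk ℓ
    by_cases hℓ : ℓ = k
    · subst hℓ
      simp only [sub_self]
      have : 0 ≤ E * u i ^ 2 := by positivity
      simpa using this
    obtain ⟨hg0, hg⟩ := poisson_of_isUnit_det hdet hk
    set d := gdist (stopMat P D ^ τ) c D k ℓ
    obtain ⟨hGi, hbound⟩ := green_mul_abs_sub_le hst hc0 hDne hconn hu0
      (fun x _ => sum_stopMat_pow_mul_valueR hP hPr hR hRD τ x) hk hg0 hg hℓ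
      (Nat.sInf_mem (hconn k hk ℓ hℓ)) i
    have hS : (stopMat P D ^ τ) k ℓ ≤ E * (c ^ d) ^ 2 :=
      (hdecay k hk ℓ hℓ τ hτ le_rfl).trans (by
        rw [hE, mul_assoc]
        exact mul_le_mul_of_nonneg_left (exp_neg_mul_sq_le hc0 hβ d) hC.le)
    have hsq : (c ^ d * (G i k * |u ℓ - u k|)) ^ 2 ≤ u i ^ 2 :=
      pow_le_pow_left₀ (by positivity) hbound 2
    calc (G i k) ^ 2 * ((stopMat P D ^ τ) k ℓ * (u ℓ - u k) ^ 2)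
        = (stopMat P D ^ τ) k ℓ * ((G i k) ^ 2 * (u ℓ - u k) ^ 2) := by ring
      _ ≤ E * (c ^ d) ^ 2 * ((G i k) ^ 2 * (u ℓ - u k) ^ 2) :=
          mul_le_mul_of_nonneg_right hS (by positivity)
      _ = E * (c ^ d * (G i k * |u ℓ - u k|)) ^ 2 := by
          rw [mul_pow, mul_pow, sq_abs]; ring
      _ ≤ E * u i ^ 2 := mul_le_mul_of_nonneg_left hsq hE0.le
  have hk : ∀ k ∈ D, (μ k)⁻¹ * (G i k) ^ 2 * ∑ ℓ, (stopMat P D ^ τ) k ℓ * (u ℓ - u k) ^ 2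
      ≤ n / α * (n * (E * u i ^ 2)) := by
    intro k hk
    rw [mul_assoc, Finset.mul_sum]
    have hμ : (μ k)⁻¹ ≤ n / α := by
      rw [← inv_div]
      exact inv_anti₀ (by positivity) (hμlb k hk)
    have hsum : ∑ ℓ, (G i k) ^ 2 * ((stopMat P D ^ τ) k ℓ * (u ℓ - u k) ^ 2)
        ≤ n * (E * u i ^ 2) := by
      simpa using Finset.sum_le_card_nsmul Finset.univ _ _ fun ℓ _ => hterm k hk ℓ
    refine mul_le_mul hμ hsum (Finset.sum_nonneg fun ℓ _ => ?_) (by positivity)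
    have := hst.1 k ℓ
    positivity
  calc ∑ k ∈ D, (μ k)⁻¹ * (G i k) ^ 2 * ∑ ℓ, (stopMat P D ^ τ) k ℓ * (u ℓ - u k) ^ 2
      ≤ D.card • (n / α * (n * (E * u i ^ 2))) := Finset.sum_le_card_nsmul _ _ _ hk
    _ ≤ n * (n / α * (n * (E * u i ^ 2))) := by
        rw [nsmul_eq_mul]
        refine mul_le_mul_of_nonneg_right ?_ (by positivity)
        exact_mod_cast (Finset.card_le_univ D).trans_eq (Fintype.card_fin n)
    _ = C / α * Real.exp ((Real.log c) ^ 2 / β) * n ^ 3 * u i ^ 2 := by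
        rw [hE]; ring

end RareTD
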